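/- arXiv:2008.03774 — 6 statements merged into one kernel-verified Lean document; each statement's English description precedes it below -/
import Mathlib

section
/- Let Γ be a finite connected graph and A a field of characteristic 0. For every 1-cochain η : E → A there exists a function f : V → A such that η - d*f is a tropical 1-form, and f is unique up to adding a constant function. -/
/-- A finite graph: a nonempty finite vertex set `V`, a finite set `E` of oriented edges
with a fixed-point-free orientation-reversing involution `rev`, and an initial-vertex map `i`. -/
structure FinGraph where
  V : Type
  E : Type
  [fintV : Fintype V]
  [decV : DecidableEq V]
  [fintE : Fintype E]
  [decE : DecidableEq E]
  nonemptyV : Nonempty V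
  rev : E → E
  rev_rev : ∀ e, rev (rev e) = e
  rev_ne : ∀ e, rev e ≠ e
  i : E → V

attribute [instance] FinGraph.fintV FinGraph.decV FinGraph.fintE FinGraph.decE

namespace FinGraph

variable (G : FinGraph)

/-- The terminal vertex of an oriented edge. -/
def t (e : G.E) : G.V := G.i (G.rev e)

/-- Two vertices are adjacent if some oriented edge goes from the first to the second. -/
def Adj (v w : G.V) : Prop := ∃ e : G.E, G.i e = v ∧ G.t e = w

/-- A graph is connected if any two vertices are joined by a chain of consecutive edges. -/
def Connected : Prop := ∀ v w : G.V, Relation.ReflTransGen G.Adj v w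

variable (A : Type) [Field A]

/-- 1-cochains with values in `A`: functions on oriented edges, odd under orientation reversal. -/
def cochains : Submodule A (G.E → A) where
  carrier := {η | ∀ e, η (G.rev e) = - η e}
  add_mem' := by
    intro a b ha hb e
    simp only [Pi.add_apply, ha e, hb e, neg_add]
  zero_mem' := by intro e; simp
  smul_mem' := by
    intro c a ha e
    simp only [Pi.smul_apply, ha e, smul_neg]

/-- Tropical (harmonic) 1-forms: 1-cochains whose values on the edges emanating
from any fixed vertex sum to zero. -/
def trop : Submodule A (G.E → A) where
  carrier := {η | (∀ e, η (G.rev e) = - η e) ∧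
    ∀ v : G.V, ∑ e ∈ Finset.univ.filter (fun e => G.i e = v), η e = 0}
  add_mem' := by
    rintro a b ⟨ha1, ha2⟩ ⟨hb1, hb2⟩
    refine ⟨fun e => ?_, fun v => ?_⟩
    · simp only [Pi.add_apply, ha1 e, hb1 e, neg_add]
    · simp [Finset.sum_add_distrib, ha2 v, hb2 v]
  zero_mem' := by exact ⟨by simp, by simp⟩
  smul_mem' := by
    rintro c a ⟨ha1, ha2⟩
    refine ⟨fun e => ?_, fun v => ?_⟩
    · simp only [Pi.smul_apply, ha1 e, smul_neg]
    · simp only [Pi.smul_apply, smul_eq_mul, ← Finset.mul_sum, ha2 v, mul_zero]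

/-- The coboundary map `d*`, sending `f : V → A` to the 1-cochain `e ↦ f (t e) - f (i e)`. -/
def dstar : (G.V → A) →ₗ[A] (G.E → A) where
  toFun f := fun e => f (G.t e) - f (G.i e)
  map_add' := by intro f g; funext e; simp only [Pi.add_apply]; ring
  map_smul' := by intro c f; funext e; simp only [Pi.smul_apply, smul_eq_mul, RingHom.id_apply]; ring

end FinGraph

namespace FinGraph

/-- The divergence of a function on oriented edges: at each vertex, the sum of the values on the
edges emanating from it. -/
def divergence (G : FinGraph) (A : Type) [Field A] : (G.E → A) →ₗ[A] (G.V → A) where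
  toFun η := fun v => ∑ e ∈ Finset.univ.filter (fun e => G.i e = v), η e
  map_add' := by intro η θ; funext v; simp [Finset.sum_add_distrib]
  map_smul' := by intro c η; funext v; simp [Finset.mul_sum]

variable {G : FinGraph} {A : Type} [Field A]

lemma divergence_apply (η : G.E → A) (v : G.V) :
    G.divergence A η v = ∑ e ∈ Finset.univ.filter (fun e => G.i e = v), η e := rfl

lemma dstar_apply (f : G.V → A) (e : G.E) : G.dstar A f e = f (G.t e) - f (G.i e) := rfl

lemma dstar_mem_cochains (f : G.V → A) : G.dstar A f ∈ G.cochains A := by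
  intro e
  simp [dstar_apply, t, G.rev_rev]

lemma mem_trop_iff {η : G.E → A} : η ∈ G.trop A ↔ η ∈ G.cochains A ∧ G.divergence A η = 0 :=
  and_congr Iff.rfl funext_iff.symm

lemma sum_comp_rev (g : G.E → A) : ∑ e, g (G.rev e) = ∑ e, g e :=
  Equiv.sum_comp (Function.Involutive.toPerm G.rev G.rev_rev) g

lemma sum_mul_divergence (f : G.V → A) (η : G.E → A) :
    ∑ v, f v * G.divergence A η v = ∑ e, f (G.i e) * η e := by
  rw [← Finset.sum_fiberwise (s := Finset.univ) (g := G.i)]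
  refine Finset.sum_congr rfl fun v _ => ?_
  rw [divergence_apply, Finset.mul_sum]
  refine Finset.sum_congr rfl fun e he => ?_
  rw [(Finset.mem_filter.mp he).2]

/-- Up to the factor `-2`, the divergence is adjoint to the coboundary on 1-cochains. -/
lemma sum_dstar_mul (f : G.V → A) {η : G.E → A} (hη : η ∈ G.cochains A) :
    ∑ e, G.dstar A f e * η e = -2 * ∑ v, f v * G.divergence A η v := by
  have h : ∑ e, f (G.t e) * η e = -∑ e, f (G.i e) * η e := by
    rw [← sum_comp_rev, ← Finset.sum_neg_distrib]
    refine Finset.sum_congr rfl fun e _ => ?_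
    rw [hη e, t, G.rev_rev, mul_neg]
  simp only [dstar_apply, sub_mul, Finset.sum_sub_distrib, h, sum_mul_divergence]
  ring

lemma sum_divergence [CharZero A] {η : G.E → A} (hη : η ∈ G.cochains A) :
    ∑ v, G.divergence A η v = 0 := by
  have h := sum_dstar_mul (fun _ => (1 : A)) hη
  simpa [dstar_apply] using h

lemma Connected.eq_of_dstar_eq_zero (hG : G.Connected) {f : G.V → A} (hf : G.dstar A f = 0)
    (v w : G.V) : f v = f w := by
  induction hG v w with
  | refl => rfl
  | tail _ h ih =>
    obtain ⟨e, rfl, rfl⟩ := h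
    rw [ih]
    exact (sub_eq_zero.mp (congrFun hf e)).symm

lemma dstar_eq_zero_of_divergence_dstar_eq_zero_rat {f : G.V → ℚ}
    (hf : G.divergence ℚ (G.dstar ℚ f) = 0) : G.dstar ℚ f = 0 := by
  have h := sum_dstar_mul f (dstar_mem_cochains f)
  simp only [hf, Pi.zero_apply, mul_zero, Finset.sum_const_zero] at h
  rw [Finset.sum_eq_zero_iff_of_nonneg fun e _ => mul_self_nonneg _] at h
  funext e
  exact mul_self_eq_zero.mp (h e (Finset.mem_univ e))

/-- Functions with vanishing Laplacian are constant: rational linear functionals on `A` separate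
points, which reduces the claim to `ℚ`. -/
lemma Connected.eq_of_divergence_dstar_eq_zero [CharZero A] (hG : G.Connected) {f : G.V → A}
    (hf : G.divergence A (G.dstar A f) = 0) (v w : G.V) : f v = f w := by
  rw [← sub_eq_zero, ← Module.forall_dual_apply_eq_zero_iff ℚ]
  intro φ
  have h : G.divergence ℚ (G.dstar ℚ (φ ∘ f)) = 0 := by
    funext u
    have hu := congrArg φ (congrFun hf u)
    simpa only [divergence_apply, dstar_apply, map_sum, map_sub, Pi.zero_apply, map_zero,
      Function.comp_apply] using hu
  rw [map_sub, sub_eq_zero]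
  exact hG.eq_of_dstar_eq_zero (dstar_eq_zero_of_divergence_dstar_eq_zero_rat h) v w

/-- The Laplacian plus the operator sending `f` to the constant function `∑ v, f v`. -/
def shiftedLaplacian (G : FinGraph) (A : Type) [Field A] : (G.V → A) →ₗ[A] (G.V → A) :=
  G.divergence A ∘ₗ G.dstar A + LinearMap.pi fun _ => ∑ v, LinearMap.proj v

lemma shiftedLaplacian_apply (f : G.V → A) (v : G.V) :
    G.shiftedLaplacian A f v = G.divergence A (G.dstar A f) v + ∑ w, f w := by
  simp [shiftedLaplacian]

lemma sum_eq_zero_of_sum_shiftedLaplacian_eq_zero [CharZero A] {f : G.V → A}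
    (hf : ∑ v, G.shiftedLaplacian A f v = 0) : ∑ v, f v = 0 := by
  have := G.nonemptyV
  simpa [shiftedLaplacian_apply, Finset.sum_add_distrib, sum_divergence (dstar_mem_cochains f)]
    using hf

lemma Connected.shiftedLaplacian_injective [CharZero A] (hG : G.Connected) :
    Function.Injective (G.shiftedLaplacian A) := by
  rw [injective_iff_map_eq_zero]
  intro f hf
  have hsum : ∑ v, f v = 0 := sum_eq_zero_of_sum_shiftedLaplacian_eq_zero (by simp [hf])
  have hlap : G.divergence A (G.dstar A f) = 0 := by
    funext v
    simpa [shiftedLaplacian_apply, hsum] using congrFun hf v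
  have := G.nonemptyV
  funext v
  rw [Finset.sum_congr rfl fun w _ => hG.eq_of_divergence_dstar_eq_zero hlap w v] at hsum
  simpa using hsum

lemma Connected.exists_divergence_dstar_eq [CharZero A] (hG : G.Connected) {g : G.V → A}
    (hg : ∑ v, g v = 0) : ∃ f : G.V → A, G.divergence A (G.dstar A f) = g := by
  obtain ⟨f, rfl⟩ :=
    LinearMap.injective_iff_surjective.mp (hG.shiftedLaplacian_injective (A := A)) g
  refine ⟨f, funext fun v => ?_⟩
  rw [shiftedLaplacian_apply, sum_eq_zero_of_sum_shiftedLaplacian_eq_zero hg, add_zero]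

end FinGraph

/-- For a finite connected graph `Γ` and a field `A` of characteristic `0`:
for every 1-cochain `η : E → A` there is a function `f : V → A` with `η - d*f` a tropical
1-form, and `f` is unique up to adding a constant. -/
theorem exists_potential_unique_up_to_constant (G : FinGraph) (hG : G.Connected)
    (A : Type) [Field A] [CharZero A] (η : G.E → A) (hη : η ∈ G.cochains A) :
    ∃ f : G.V → A, η - G.dstar A f ∈ G.trop A ∧
      ∀ f' : G.V → A, η - G.dstar A f' ∈ G.trop A → ∃ c : A, ∀ v : G.V, f' v = f v + c := by
  obtain ⟨f, hf⟩ := hG.exists_divergence_dstar_eq (FinGraph.sum_divergence hη)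
  refine ⟨f, FinGraph.mem_trop_iff.mpr
    ⟨Submodule.sub_mem _ hη (FinGraph.dstar_mem_cochains f), by rw [map_sub, hf, sub_self]⟩,
    fun f' hf' => ?_⟩
  have h' := (FinGraph.mem_trop_iff.mp hf').2
  rw [map_sub, sub_eq_zero] at h'
  have h : G.divergence A (G.dstar A (f' - f)) = 0 := by
    rw [map_sub, map_sub, hf, ← h', sub_self]
  obtain ⟨v₀⟩ := G.nonemptyV
  refine ⟨f' v₀ - f v₀, fun v => ?_⟩
  rw [← sub_eq_iff_eq_add']
  exact hG.eq_of_divergence_dstar_eq_zero h v v₀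
end

section
/- Let Γ be a finite graph and A a field of characteristic 0. The bilinear pairing ⟨c, η⟩ := (1/2) Σ_{e ∈ E} c(e) η(e) on H_1(Γ, A) × Ω¹_trop(Γ, A) is nondegenerate: if η is a tropical 1-form with ⟨c, η⟩ = 0 for every 1-cycle c, then η = 0, and if c is a 1-cycle with ⟨c, η⟩ = 0 for every tropical 1-form η, then c = 0. -/
namespace FinGraph

variable (G : FinGraph) (A : Type) [Field A]

/-- Under the identification of 1-chains with 1-cochains (2 being invertible),
the first homology `H_1(Γ, A)` is the space of 1-cochains `c` with
`∑_{e : i(e)=v} c(e) = 0` for every vertex `v`. -/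
def cycles : Submodule A (G.E → A) := G.trop A

/-- The pairing `⟨c, η⟩ = (1/2) ∑_e c(e) η(e)` between 1-chains and 1-cochains. -/
def pair (c η : G.E → A) : A := (∑ e : G.E, c e * η e) / 2

end FinGraph

namespace FinGraph

variable {G : FinGraph} {A : Type} [Field A]

/-- Tropical 1-forms are preserved by additive maps on the coefficients. -/
theorem comp_mem_trop {B : Type} [Field B] (φ : A →+ B) {η : G.E → A} (hη : η ∈ G.trop A) :
    (fun e => φ (η e)) ∈ G.trop B := by
  refine ⟨fun e => ?_, fun v => ?_⟩
  · simp only [hη.1 e, map_neg]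
  · rw [← map_sum, hη.2 v, map_zero]

theorem pair_comm (c η : G.E → A) : G.pair A c η = G.pair A η c := by
  simp only [pair, mul_comm]

/-- A tropical 1-form orthogonal to all tropical 1-forms vanishes. Each `ℚ`-linear functional `φ`
on `A` turns it into a rational tropical 1-form whose sum of squares is zero. -/
theorem eq_zero_of_forall_pair_eq_zero [CharZero A] {η : G.E → A} (hη : η ∈ G.trop A)
    (h : ∀ c ∈ G.trop A, G.pair A c η = 0) : η = 0 := by
  funext e
  refine (Module.forall_dual_apply_eq_zero_iff ℚ (η e)).1 fun φ => ?_
  have hφ : (fun e => φ (η e)) ∈ G.trop ℚ := comp_mem_trop φ.toAddMonoidHom hη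
  have hc := h _ (comp_mem_trop (algebraMap ℚ A).toAddMonoidHom hφ)
  have hsum : ∑ e, φ (η e) • η e = 0 := by
    simpa [pair, Algebra.smul_def] using hc
  have hsq : ∑ e, φ (η e) * φ (η e) = 0 := by
    simpa using congrArg φ hsum
  rw [Finset.sum_eq_zero_iff_of_nonneg fun e _ => mul_self_nonneg _] at hsq
  exact mul_self_eq_zero.1 (hsq e (Finset.mem_univ e))

end FinGraph

/-- For a finite graph `Γ` and a field `A` of characteristic `0`, the pairing
`⟨c, η⟩ = (1/2) ∑_e c(e) η(e)` between `H_1(Γ, A)` and `Ω¹_trop(Γ, A)` is nondegenerate. -/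
theorem pairing_nondegenerate (G : FinGraph) (A : Type) [Field A] [CharZero A] :
    (∀ η ∈ G.trop A, (∀ c ∈ G.cycles A, G.pair A c η = 0) → η = 0) ∧
    (∀ c ∈ G.cycles A, (∀ η ∈ G.trop A, G.pair A c η = 0) → c = 0) := by
  exact ⟨fun η hη h => FinGraph.eq_zero_of_forall_pair_eq_zero hη h,
    fun c hc h => FinGraph.eq_zero_of_forall_pair_eq_zero hc fun η hη =>
      (FinGraph.pair_comm η c).trans (h η hη)⟩
end

section
/- Let K be a field of characteristic 0, g ∈ K[X] squarefree of degree d ≥ 1, and L = K(X)[Y]/(Y² - g(X)) the function field of the curve y² = g(x). For every polynomial p ∈ K[X] there exist a polynomial q ∈ K[X] and a polynomial r ∈ K[X] with deg r ≤ d - 2 (with r = 0 when d ≤ 1) such that, in Ω_{L/K}, p(x) · (2y)^{-1} · dx = d( q(x)·y ) + r(x) · (2y)^{-1} · dx. (Reduction of the pole order at the point(s) at infinity, Section 5.5.) -/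
open Polynomial

noncomputable section

/-- The polynomial `Y² - g(X)` over the rational function field `K(X)`. -/
def hypPoly (K : Type) [Field K] (g : K[X]) : Polynomial (RatFunc K) :=
  Polynomial.X ^ 2 - Polynomial.C (algebraMap K[X] (RatFunc K) g)

/-- The function field `L = K(X)[Y]/(Y² - g(X))` of the hyperelliptic curve `y² = g(x)`.
(When `g` is squarefree of degree `≥ 1`, the polynomial `Y² - g(X)` is irreducible over
`K(X)` and `L` is a field.) -/
abbrev HypFF (K : Type) [Field K] (g : K[X]) : Type := AdjoinRoot (hypPoly K g)

variable (K : Type) [Field K] (g : K[X])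

/-- The coordinate function `x ∈ L`, the image of `X`. -/
def xCoord : HypFF K g := AdjoinRoot.of (hypPoly K g) RatFunc.X

/-- The coordinate function `y ∈ L`, the image of `Y`; it satisfies `y² = g(x)`. -/
def yCoord : HypFF K g := AdjoinRoot.root (hypPoly K g)

end

/-- Euclidean-type division by the operator `q ↦ 2 (dq/dX) g + q (dg/dX)`, which raises
degrees by `deg g - 1`. -/
theorem exists_eq_two_mul_derivative_mul_add {K : Type*} [Field K] [CharZero K] {g : K[X]}
    (hd : 1 ≤ g.natDegree) (p : K[X]) :
    ∃ q r : K[X], p = 2 * derivative q * g + q * derivative g + r ∧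
      r.degree < (g.natDegree - 1 : ℕ) := by
  induction hn : p.degree using WellFoundedLT.induction generalizing p with
  | ind n ih =>
    subst hn
    by_cases hp : p.degree < (g.natDegree - 1 : ℕ)
    · exact ⟨0, p, by simp, hp⟩
    push Not at hp
    have hp0 : p ≠ 0 := by
      rintro rfl
      simp at hp
    obtain ⟨n, hn⟩ := Nat.exists_eq_add_of_le (le_natDegree_of_coe_le_degree hp)
    have hlg : g.leadingCoeff ≠ 0 := leadingCoeff_ne_zero.mpr (by rintro rfl; simp at hd)
    have hnd : (2 * n + g.natDegree : K) ≠ 0 := by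
      norm_cast
      omega
    set a : K := p.leadingCoeff / (g.leadingCoeff * (2 * n + g.natDegree)) with ha
    have ha0 : p.leadingCoeff = a * (g.leadingCoeff * (2 * n + g.natDegree)) := by
      rw [ha]
      field_simp
    set q₀ : K[X] := C a * X ^ n with hq₀
    set t : K[X] := 2 * derivative q₀ * g + q₀ * derivative g with ht
    have hg' : (derivative g).natDegree ≤ g.natDegree - 1 := natDegree_derivative_le g
    have hcoeff : (q₀ * derivative g).coeff p.natDegree = a * (g.leadingCoeff * g.natDegree) := by
      rw [hn, hq₀, mul_assoc, coeff_C_mul, coeff_X_pow_mul, coeff_derivative,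
        Nat.sub_add_cancel hd, ← Nat.cast_succ, Nat.succ_eq_add_one, Nat.sub_add_cancel hd,
        coeff_natDegree]
    have hcoeff' : (2 * derivative q₀ * g).coeff p.natDegree =
        a * (g.leadingCoeff * (2 * n)) := by
      have : 2 * derivative q₀ * g = C (2 * a * n) * (X ^ (n - 1) * g) := by
        simp only [hq₀, derivative_C_mul_X_pow, C_mul, map_ofNat]
        ring
      rw [this, coeff_C_mul]
      rcases n with _ | n
      · simp
      · rw [hn, show g.natDegree - 1 + (n + 1) = g.natDegree + n by omega, Nat.add_sub_cancel,
          coeff_X_pow_mul, coeff_natDegree]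
        ring
    have htc : t.coeff p.natDegree = p.leadingCoeff := by
      rw [ht, coeff_add, hcoeff, hcoeff', ha0]
      ring
    have hq₀d : q₀.natDegree ≤ n := natDegree_C_mul_X_pow_le a n
    have htd : t.natDegree ≤ p.natDegree := by
      refine natDegree_add_le_of_degree_le ?_ ?_
      · rcases n with _ | n
        · simp [hq₀]
        · have h2 : (2 * derivative q₀).natDegree ≤ n := by
            rw [← map_ofNat C 2]
            refine (natDegree_C_mul_le _ _).trans ((natDegree_derivative_le _).trans ?_)
            omega
          refine natDegree_mul_le.trans ?_
          omega
      · refine natDegree_mul_le.trans ?_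
        omega
    have hlt : (p - t).degree < p.degree := by
      rw [degree_eq_natDegree hp0, degree_lt_iff_coeff_zero]
      intro m hm
      rcases hm.eq_or_lt with rfl | hm
      · rw [coeff_sub, htc, coeff_natDegree, sub_self]
      · rw [coeff_sub, coeff_eq_zero_of_natDegree_lt hm,
          coeff_eq_zero_of_natDegree_lt (htd.trans_lt hm), sub_zero]
    obtain ⟨q, r, hqr, hr⟩ := ih _ hlt (p - t) rfl
    refine ⟨q₀ + q, r, ?_, hr⟩
    rw [sub_eq_iff_eq_add] at hqr
    rw [hqr, ht, derivative_add]
    ring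

/-- If `y² = g(x)` with `2y ≠ 0`, then `d(q(x) y)` is `(2y)⁻¹ dx` times the value at `x` of
`2 (dq/dX) g + q (dg/dX)`. -/
theorem Derivation.apply_aeval_mul_of_sq_eq {K L M : Type*} [Field K] [Field L] [Algebra K L]
    [AddCommGroup M] [Module K M] [Module L M] [IsScalarTower K L M] (D : Derivation K L M)
    {g : K[X]} {x y : L} (hy : y ^ 2 = aeval x g) (hy0 : 2 * y ≠ 0) (q : K[X]) :
    D (aeval x q * y) =
      (aeval x (2 * derivative q * g + q * derivative g) * (2 * y)⁻¹) • D x := by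
  have hDy : D y = (aeval x (derivative g) * (2 * y)⁻¹) • D x := by
    have h := congrArg D hy
    rw [D.leibniz_pow, D.map_aeval, ← Nat.cast_smul_eq_nsmul L, smul_smul] at h
    norm_num at h
    rw [mul_comm, mul_smul, ← h, smul_smul, inv_mul_cancel₀ hy0, one_smul]
  rw [D.leibniz, hDy, D.map_aeval, smul_smul, smul_smul, ← add_smul]
  congr 1
  simp only [map_add, map_mul, map_ofNat, ← hy]
  field_simp [left_ne_zero_of_mul hy0, right_ne_zero_of_mul hy0]
  ring

theorem aeval_xCoord (K : Type) [Field K] (g p : K[X]) :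
    aeval (xCoord K g) p = AdjoinRoot.of (hypPoly K g) (algebraMap K[X] (RatFunc K) p) := by
  have h : xCoord K g = algebraMap (RatFunc K) (HypFF K g) RatFunc.X := rfl
  rw [h, aeval_algebraMap_apply, ← RatFunc.algebraMap_X, aeval_algebraMap_apply, aeval_X_left_apply]
  rfl

theorem yCoord_sq (K : Type) [Field K] (g : K[X]) :
    yCoord K g ^ 2 = aeval (xCoord K g) g := by
  have h := AdjoinRoot.eval₂_root (hypPoly K g)
  rw [aeval_xCoord, yCoord, ← sub_eq_zero]
  conv at h => enter [1, 3]; rw [hypPoly]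
  simpa only [eval₂_sub, eval₂_X_pow, eval₂_C] using h

/-- Reduction of the pole order at infinity: in `Ω_{L/K}` for
`L = K(X)[Y]/(Y² - g(X))` with `g` squarefree of degree `d ≥ 1`, every differential
`p(x)·(2y)^{-1}·dx` with `p ∈ K[X]` equals `d(q(x)·y) + r(x)·(2y)^{-1}·dx` for some
`q, r ∈ K[X]` with `deg r ≤ d - 2` (and `r = 0` when `d ≤ 1`). -/
theorem pole_reduction_at_infinity (K : Type) [Field K] [CharZero K] (g : K[X])
    (hg : Squarefree g) (hd : 1 ≤ g.natDegree) [Fact (Irreducible (hypPoly K g))]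
    (p : K[X]) :
    ∃ q r : K[X], r.natDegree ≤ g.natDegree - 2 ∧ (g.natDegree ≤ 1 → r = 0) ∧
      (Polynomial.aeval (xCoord K g) p * (2 * yCoord K g)⁻¹) •
          KaehlerDifferential.D K (HypFF K g) (xCoord K g) =
        KaehlerDifferential.D K (HypFF K g) (Polynomial.aeval (xCoord K g) q * yCoord K g) +
          (Polynomial.aeval (xCoord K g) r * (2 * yCoord K g)⁻¹) •
            KaehlerDifferential.D K (HypFF K g) (xCoord K g) := by
  obtain ⟨q, r, hp, hr⟩ := exists_eq_two_mul_derivative_mul_add hd p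
  have : CharZero (HypFF K g) := charZero_of_injective_algebraMap (algebraMap K _).injective
  have hg0 : g ≠ 0 := hg.ne_zero
  have hy0 : 2 * yCoord K g ≠ 0 := by
    refine mul_ne_zero two_ne_zero (pow_ne_zero_iff two_ne_zero |>.mp ?_)
    rw [yCoord_sq, aeval_xCoord]
    exact (_root_.map_ne_zero _).mpr (RatFunc.algebraMap_ne_zero hg0)
  refine ⟨q, r, ?_, fun h ↦ ?_, ?_⟩
  · rcases eq_or_ne r 0 with rfl | hr0
    · simp
    · have := (natDegree_lt_iff_degree_lt hr0).mpr hr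
      omega
  · rw [show g.natDegree - 1 = 0 by omega] at hr
    simpa [Nat.WithBot.lt_zero_iff] using hr
  · rw [Derivation.apply_aeval_mul_of_sq_eq _ (yCoord_sq K g) hy0, ← add_smul, ← add_mul,
      ← map_add, ← hp]
end

section
/- Let K be a field of characteristic 0, g ∈ K[X] squarefree of degree d ≥ 1, and L = K(X)[Y]/(Y² - g(X)) the function field of the curve y² = g(x). If β ∈ K is a root of g (a Weierstrass point), then for every integer n ≥ 1 there exist constants c_1, …, c_n ∈ K and a polynomial w ∈ K[X] such that, in Ω_{L/K}, (x-β)^{-n} · (2y)^{-1} · dx = d( Σ_{m=1}^n c_m · y · (x-β)^{-m} ) + w(x) · (2y)^{-1} · dx. (Cancellation of poles at Weierstrass points by exact differentials, Section 5.5.) -/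
open Polynomial

section PoleReduction

variable {K L M : Type*} [Field K] [CharZero K] [Field L] [Algebra K L] [AddCommGroup M]
  [Module K M] [Module L M]

/-- On the curve `y² = (x - β) h(x)`, the differential of `y (x - β)⁻ᵐ` is
`((1 - 2m) h(x) + (x - β) (dh/dx)(x)) (x - β)⁻ᵐ (2y)⁻¹ dx`. -/
theorem Derivation.map_mul_inv_pow_sub_of_sq_eq (D : Derivation K L M) {x y : L} {β : K}
    {h : K[X]} (hy : y ≠ 0) (hx : x - algebraMap K L β ≠ 0)
    (hxy : y ^ 2 = aeval x ((X - C β) * h)) (m : ℕ) :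
    D (y * ((x - algebraMap K L β) ^ m)⁻¹) =
      (aeval x (C (1 - 2 * (m : K)) * h + (X - C β) * derivative h) *
        ((x - algebraMap K L β) ^ m)⁻¹ * (2 * y)⁻¹) • D x := by
  have : CharZero L := charZero_of_injective_algebraMap (algebraMap K L).injective
  have hdy : D y = (aeval x (derivative ((X - C β) * h)) * (2 * y)⁻¹) • D x := by
    have h1 : (2 * y) • D y = aeval x (derivative ((X - C β) * h)) • D x := by
      rw [← D.map_aeval, ← hxy, pow_two, D.leibniz, ← add_smul, two_mul]
    rw [mul_comm, mul_smul, ← h1, smul_smul, inv_mul_cancel₀ (by simpa using hy), one_smul]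
  have hdx : D (((x - algebraMap K L β) ^ m)⁻¹) =
      (-(m : L) * ((x - algebraMap K L β) ^ m)⁻¹ * (x - algebraMap K L β)⁻¹) • D x := by
    rcases m with _ | m
    · simp
    · rw [D.leibniz_inv, D.leibniz_pow, map_sub, D.map_algebraMap, sub_zero,
        ← Nat.cast_smul_eq_nsmul L, smul_smul, smul_smul]
      congr 1
      simp only [Nat.add_sub_cancel]
      field_simp
      rw [pow_succ']
  rw [D.leibniz, hdx, hdy, smul_smul, smul_smul, ← add_smul]
  congr 1
  rw [derivative_mul, derivative_X_sub_C, one_mul]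
  simp only [map_add, map_mul, map_sub, aeval_X, aeval_C, map_one, map_ofNat] at hxy ⊢
  field_simp
  rw [hxy, _root_.map_natCast]
  ring

/-- On the curve `y² = (x - β) h(x)` with `h(β) ≠ 0`, poles at `x = β` of differentials
`p(x) (x - β)⁻ⁿ (2y)⁻¹ dx` can be cancelled by exact differentials. -/
theorem Derivation.exists_pole_reduction_of_sq_eq [IsScalarTower K L M]
    (D : Derivation K L M) {x y : L} {β : K} {h : K[X]} (hy : y ≠ 0) (hx : x - algebraMap K L β ≠ 0)
    (hxy : y ^ 2 = aeval x ((X - C β) * h)) (hβ : h.eval β ≠ 0) (n : ℕ) (p : K[X]) :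
    ∃ (c : Fin n → K) (w : K[X]),
      (aeval x p * ((x - algebraMap K L β) ^ n)⁻¹ * (2 * y)⁻¹) • D x =
        D (∑ m : Fin n, c m • (y * ((x - algebraMap K L β) ^ ((m : ℕ) + 1))⁻¹)) +
          (aeval x w * (2 * y)⁻¹) • D x := by
  induction n generalizing p with
  | zero => exact ⟨Fin.elim0, p, by simp⟩
  | succ n ih =>
    set r : K[X] := C (1 - 2 * ((n + 1 : ℕ) : K)) * h + (X - C β) * derivative h with hr
    have hr0 : r.eval β ≠ 0 := by
      have h2 : (1 - 2 * ((n + 1 : ℕ) : K)) ≠ 0 := by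
        rw [sub_ne_zero]
        norm_cast
        lia
      simpa [hr] using And.intro (by simpa using h2) hβ
    obtain ⟨q, hq⟩ : X - C β ∣ p - C (p.eval β / r.eval β) * r := by
      rw [dvd_iff_isRoot]
      simp [hr0]
    obtain ⟨c, w, hcw⟩ := ih q
    refine ⟨Fin.snoc c (p.eval β / r.eval β), w, ?_⟩
    have hp : aeval x p = algebraMap K L (p.eval β / r.eval β) * aeval x r +
        (x - algebraMap K L β) * aeval x q := by
      rw [sub_eq_iff_eq_add'] at hq
      simpa using congrArg (aeval x) hq
    simp only [Fin.sum_univ_castSucc, Fin.snoc_castSucc, Fin.snoc_last, Fin.val_castSucc,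
      Fin.val_last, map_add]
    rw [add_right_comm, ← hcw, D.map_smul, D.map_mul_inv_pow_sub_of_sq_eq hy hx hxy, ← hr,
      ← algebraMap_smul L (p.eval β / r.eval β), smul_smul, ← add_smul, hp]
    congr 1
    field_simp
    ring

end PoleReduction

/-- Cancellation of poles at a Weierstrass point: in `Ω_{L/K}` for
`L = K(X)[Y]/(Y² - g(X))` with `g` squarefree of degree `≥ 1`, if `g(β) = 0` then for every
`n ≥ 1` there are `c_1, …, c_n ∈ K` and `w ∈ K[X]` with
`(x-β)^{-n}·(2y)^{-1}·dx = d(∑_{m=1}^n c_m·y·(x-β)^{-m}) + w(x)·(2y)^{-1}·dx`. -/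
theorem pole_reduction_at_weierstrass (K : Type) [Field K] [CharZero K] (g : K[X])
    (hg : Squarefree g) (hd : 1 ≤ g.natDegree) [Fact (Irreducible (hypPoly K g))]
    (β : K) (hβ : g.eval β = 0) (n : ℕ) (hn : 1 ≤ n) :
    ∃ (c : Fin n → K) (w : K[X]),
      (((xCoord K g - algebraMap K (HypFF K g) β) ^ n)⁻¹ * (2 * yCoord K g)⁻¹) •
          KaehlerDifferential.D K (HypFF K g) (xCoord K g) =
        KaehlerDifferential.D K (HypFF K g)
            (∑ m : Fin n, c m •
              (yCoord K g * ((xCoord K g - algebraMap K (HypFF K g) β) ^ ((m : ℕ) + 1))⁻¹)) +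
          (Polynomial.aeval (xCoord K g) w * (2 * yCoord K g)⁻¹) •
            KaehlerDifferential.D K (HypFF K g) (xCoord K g) := by
  obtain ⟨h, rfl⟩ : X - C β ∣ g := dvd_iff_isRoot.mpr hβ
  have hh : h.eval β ≠ 0 := fun h0 => by
    obtain ⟨k, rfl⟩ : X - C β ∣ h := dvd_iff_isRoot.mpr h0
    exact not_isUnit_X_sub_C β (hg (X - C β) ⟨k, (mul_assoc _ _ _).symm⟩)
  have haeval (p : K[X]) : aeval (xCoord K ((X - C β) * h)) p =
      AdjoinRoot.of (hypPoly K ((X - C β) * h)) (algebraMap K[X] (RatFunc K) p) := by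
    refine RingHom.congr_fun (f := (aeval (xCoord K ((X - C β) * h))).toRingHom)
      (g := (AdjoinRoot.of _).comp (algebraMap K[X] (RatFunc K))) ?_ p
    refine Polynomial.ringHom_ext (fun a => ?_) ?_
    · simp [← RatFunc.algebraMap_eq_C, AdjoinRoot.algebraMap_eq']
    · simp [xCoord]
  have hinj := (AdjoinRoot.of (hypPoly K ((X - C β) * h))).injective.comp
    (RatFunc.algebraMap_injective K)
  have hxy : yCoord K ((X - C β) * h) ^ 2 =
      aeval (xCoord K ((X - C β) * h)) ((X - C β) * h) := by
    have hmk : AdjoinRoot.mk (hypPoly K ((X - C β) * h))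
        (X ^ 2 - C (algebraMap K[X] (RatFunc K) ((X - C β) * h))) = 0 := AdjoinRoot.mk_self
    rw [map_sub, map_pow, AdjoinRoot.mk_X, AdjoinRoot.mk_C, sub_eq_zero] at hmk
    rw [haeval]
    exact hmk
  have hy : yCoord K ((X - C β) * h) ≠ 0 := by
    intro h0
    rw [h0, zero_pow two_ne_zero, haeval] at hxy
    exact hg.ne_zero (hinj (by simpa using hxy.symm))
  have hx : xCoord K ((X - C β) * h) - algebraMap K _ β ≠ 0 := by
    intro h0
    refine X_sub_C_ne_zero β (hinj ?_)
    have := haeval (X - C β)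
    simp only [map_sub, aeval_X, aeval_C] at this
    simpa [h0] using this.symm
  simpa using (KaehlerDifferential.D K (HypFF K ((X - C β) * h))).exists_pole_reduction_of_sq_eq
    hy hx hxy hh n 1
end

section
/- Let K be a field of characteristic 0, g ∈ K[X] squarefree of degree d ≥ 1, and L = K(X)[Y]/(Y² - g(X)) the function field of the curve y² = g(x). If β ∈ K with g(β) ≠ 0, then for every integer n ≥ 2 there exist constants c_1, …, c_{n-1} ∈ K, a constant a ∈ K and a polynomial w ∈ K[X] such that, in Ω_{L/K}, (x-β)^{-n} · (2y)^{-1} · dx = d( Σ_{m=1}^{n-1} c_m · y · (x-β)^{-m} ) + a · ( (x-β) · 2y )^{-1} · dx + w(x) · (2y)^{-1} · dx. (Reduction of higher-order poles at non-Weierstrass points to simple poles, Section 5.5.) -/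
open Polynomial

section PoleReduction

variable {K L M : Type*} [Field K] [CharZero K] [Field L] [Algebra K L]
  [AddCommGroup M] [Module K M] [Module L M]

/-- If `y² = g(x)` and `h` is the derivative of `g`, then
`D (y (x - β)⁻⁽ᵏ⁺¹⁾) = ((x - β) h(x) - 2 (k + 1) g(x)) (x - β)⁻⁽ᵏ⁺²⁾ (2y)⁻¹ D x`. -/
theorem derivation_mul_inv_sub_pow (D : Derivation K L M) {g : K[X]} {x y : L} {β : K}
    (hy : y ^ 2 = aeval x g) (hy0 : y ≠ 0) (hx : x - algebraMap K L β ≠ 0) (k : ℕ) :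
    D (y * ((x - algebraMap K L β) ^ (k + 1))⁻¹) =
      (aeval x ((X - C β) * derivative g - C (2 * ((k : K) + 1)) * g) *
        ((x - algebraMap K L β) ^ (k + 2))⁻¹ * (2 * y)⁻¹) • D x := by
  have : CharZero L := charZero_of_injective_algebraMap (algebraMap K L).injective
  have h2y : 2 * y ≠ 0 := mul_ne_zero two_ne_zero hy0
  have hDy : D y = (aeval x (derivative g) * (2 * y)⁻¹) • D x := by
    have h : (2 * y) • D y = aeval x (derivative g) • D x := by
      rw [← D.map_aeval, ← hy, D.leibniz_pow, two_nsmul, ← two_smul L, smul_smul]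
      simp
    rw [mul_comm, mul_smul, ← h, inv_smul_smul₀ h2y]
  have hDt : D ((x - algebraMap K L β) ^ (k + 1)) =
      (((k : L) + 1) * (x - algebraMap K L β) ^ k) • D x := by
    rw [D.leibniz_pow, ← Nat.cast_smul_eq_nsmul L, smul_smul, map_sub, D.map_algebraMap]
    simp
  rw [D.leibniz, D.leibniz_inv, hDt, hDy, smul_smul, smul_smul, smul_smul, ← add_smul]
  congr 1
  simp only [map_sub, map_mul, aeval_X, aeval_C, ← hy, map_add, map_natCast, map_one, map_ofNat]
  field_simp
  ring

/-- Pole reduction for `p(x) (x - β)⁻⁽ᵏ⁺¹⁾ (2y)⁻¹ D x` with an arbitrary numerator `p`. -/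
theorem exists_pole_reduction (D : Derivation K L M) {g : K[X]} {x y : L} {β : K}
    (hy : y ^ 2 = aeval x g) (hy0 : y ≠ 0) (hx : x - algebraMap K L β ≠ 0)
    (hβ : g.eval β ≠ 0) (k : ℕ) (p : K[X]) :
    ∃ (c : Fin k → K) (a : K) (w : K[X]),
      (aeval x p * ((x - algebraMap K L β) ^ (k + 1))⁻¹ * (2 * y)⁻¹) • D x =
        D (∑ m : Fin k, c m • (y * ((x - algebraMap K L β) ^ ((m : ℕ) + 1))⁻¹)) +
          (algebraMap K L a * ((x - algebraMap K L β) * (2 * y))⁻¹) • D x +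
          (aeval x w * (2 * y)⁻¹) • D x := by
  induction k generalizing p with
  | zero =>
    obtain ⟨w, hw⟩ := X_sub_C_dvd_sub_C_eval (a := β) (p := p)
    refine ⟨Fin.elim0, p.eval β, w, ?_⟩
    have hp : aeval x p = algebraMap K L (p.eval β) + (x - algebraMap K L β) * aeval x w := by
      rw [eq_add_of_sub_eq' hw]
      simp
    rw [Finset.univ_eq_empty, Finset.sum_empty, map_zero, zero_add (_ • _), ← add_smul, hp]
    congr 1
    field_simp
    ring
  | succ k ih =>
    set q : K[X] := (X - C β) * derivative g - C (2 * ((k : K) + 1)) * g with hq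
    have hqβ : q.eval β ≠ 0 := by
      simp [hq, hβ, Nat.cast_add_one_ne_zero]
    set e : K := p.eval β / q.eval β with he
    obtain ⟨r, hr⟩ : X - C β ∣ p - C e * q := by
      rw [dvd_iff_isRoot]
      simp [he, hqβ]
    obtain ⟨c, a, w, h⟩ := ih r
    refine ⟨Fin.snoc c e, a, w, ?_⟩
    have hp : aeval x p = algebraMap K L e * aeval x q + (x - algebraMap K L β) * aeval x r := by
      rw [eq_add_of_sub_eq' hr]
      simp
    rw [Fin.sum_univ_castSucc]
    simp only [Fin.snoc_castSucc, Fin.snoc_last, Fin.val_castSucc, Fin.val_last]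
    rw [map_add, add_right_comm (D _), add_right_comm (_ + _) (D _), ← h, Algebra.smul_def, D.leibniz,
      D.map_algebraMap, smul_zero, add_zero, derivation_mul_inv_sub_pow D hy hy0 hx, ← hq,
      smul_smul, ← add_smul, hp]
    congr 1
    field_simp
    ring

end PoleReduction

/-- Reduction of higher-order poles at a non-Weierstrass point: in `Ω_{L/K}`
for `L = K(X)[Y]/(Y² - g(X))` with `g` squarefree of degree `≥ 1`, if `g(β) ≠ 0` then for
every `n ≥ 2` there are `c_1, …, c_{n-1} ∈ K`, `a ∈ K` and `w ∈ K[X]` with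
`(x-β)^{-n}·(2y)^{-1}·dx = d(∑_{m=1}^{n-1} c_m·y·(x-β)^{-m}) + a·((x-β)·2y)^{-1}·dx
  + w(x)·(2y)^{-1}·dx`. -/
theorem pole_reduction_at_non_weierstrass (K : Type) [Field K] [CharZero K] (g : K[X])
    (hg : Squarefree g) (hd : 1 ≤ g.natDegree) [Fact (Irreducible (hypPoly K g))]
    (β : K) (hβ : g.eval β ≠ 0) (n : ℕ) (hn : 2 ≤ n) :
    ∃ (c : Fin (n - 1) → K) (a : K) (w : K[X]),
      (((xCoord K g - algebraMap K (HypFF K g) β) ^ n)⁻¹ * (2 * yCoord K g)⁻¹) •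
          KaehlerDifferential.D K (HypFF K g) (xCoord K g) =
        KaehlerDifferential.D K (HypFF K g)
            (∑ m : Fin (n - 1), c m •
              (yCoord K g * ((xCoord K g - algebraMap K (HypFF K g) β) ^ ((m : ℕ) + 1))⁻¹)) +
          (algebraMap K (HypFF K g) a *
              ((xCoord K g - algebraMap K (HypFF K g) β) * (2 * yCoord K g))⁻¹) •
            KaehlerDifferential.D K (HypFF K g) (xCoord K g) +
          (Polynomial.aeval (xCoord K g) w * (2 * yCoord K g)⁻¹) •
            KaehlerDifferential.D K (HypFF K g) (xCoord K g) := by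
  obtain ⟨k, rfl⟩ : ∃ k, n = k + 1 := ⟨n - 1, by omega⟩
  have hgx : aeval (xCoord K g) g =
      algebraMap (RatFunc K) (HypFF K g) (algebraMap K[X] (RatFunc K) g) := by
    have hX : aeval (RatFunc.X : RatFunc K) g = algebraMap K[X] (RatFunc K) g := by
      rw [← RatFunc.algebraMap_X, aeval_algebraMap_apply, aeval_X_left_apply]
    rw [← hX]
    exact aeval_algebraMap_apply _ _ _
  have hy : yCoord K g ^ 2 = aeval (xCoord K g) g := by
    have h : (hypPoly K g).eval₂ (AdjoinRoot.of (hypPoly K g)) (yCoord K g) = 0 :=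
      AdjoinRoot.eval₂_root _
    have hP : hypPoly K g = X ^ 2 - C (algebraMap K[X] (RatFunc K) g) := rfl
    rw [congrArg (eval₂ (AdjoinRoot.of (hypPoly K g)) (yCoord K g)) hP, eval₂_sub,
      eval₂_pow, eval₂_X, eval₂_C, sub_eq_zero] at h
    exact h.trans hgx.symm
  have hx : xCoord K g - algebraMap K (HypFF K g) β ≠ 0 := by
    have h : (RatFunc.X - algebraMap K (RatFunc K) β : RatFunc K) ≠ 0 := by
      have := (map_ne_zero_iff _ (RatFunc.algebraMap_injective K)).2 (X_sub_C_ne_zero β)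
      simpa using this
    have := (map_ne_zero (algebraMap (RatFunc K) (HypFF K g))).2 h
    rwa [map_sub, ← IsScalarTower.algebraMap_apply] at this
  have hy0 : yCoord K g ≠ 0 := by
    have hg0 : algebraMap K[X] (RatFunc K) g ≠ 0 :=
      (map_ne_zero_iff _ (RatFunc.algebraMap_injective K)).2 hg.ne_zero
    rw [← pow_ne_zero_iff two_ne_zero, hy, hgx]
    exact (_root_.map_ne_zero _).2 hg0
  simpa using exists_pole_reduction (KaehlerDifferential.D K (HypFF K g)) hy hy0 hx hβ k 1
end

section
/- Let K be an algebraically closed field of characteristic 0, g ∈ K[X] squarefree of degree d ≥ 1, and L = K(X)[Y]/(Y² - g(X)) the function field of the curve y² = g(x). For every rational function s ∈ K(X) there exist an element F ∈ L, constants c_0, …, c_{d-2} ∈ K, finitely many points β_1, …, β_k ∈ K with g(β_j) ≠ 0 for all j, and constants d_1, …, d_k ∈ K, such that in Ω_{L/K}: s(x) · (2y)^{-1} · dx = dF + Σ_{i=0}^{d-2} c_i · x^i · (2y)^{-1} · dx + Σ_{j=1}^{k} d_j · ( (x-β_j) · 2y )^{-1} · dx. (The pole reduction identity (5.2) of the paper: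 every anti-invariant meromorphic differential is, modulo exact differentials, a K-linear combination of the basis differentials ω_i = x^i dx/(2y) and ν_β = dx/((x-β)·2y).) -/
open Polynomial

section PartialFractions

/-- Over an algebraically closed field, the fractions `p / (X - β) ^ n` span the rational
functions. -/
theorem mem_of_forall_div_X_sub_C_pow_mem {K : Type*} [Field K] [IsAlgClosed K]
    (V : Submodule K (RatFunc K))
    (hV : ∀ (p : K[X]) (β : K) (n : ℕ),
      algebraMap K[X] (RatFunc K) p * (algebraMap K[X] (RatFunc K) (X - C β))⁻¹ ^ n ∈ V)
    (s : RatFunc K) : s ∈ V := by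
  classical
  have hne (β : K) : algebraMap K[X] (RatFunc K) (X - C β) ≠ 0 :=
    RatFunc.algebraMap_ne_zero (X_sub_C_ne_zero β)
  have hden : s.denom = ∏ β ∈ s.denom.roots.toFinset, (X - C β) ^ s.denom.roots.count β := by
    rw [← Finset.prod_multiset_map_count]
    exact (IsAlgClosed.splits s.denom).eq_prod_roots_of_monic s.monic_denom
  obtain ⟨q, r, -, h⟩ := mul_prod_pow_inverse_eq_quo_add_sum_rem_mul_pow_inverse
    (K := RatFunc K) (s := s.denom.roots.toFinset) s.num (g := fun β : K => X - C β)
    (fun β _ => monic_X_sub_C β)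
    (fun _ _ _ _ hab => isCoprime_X_sub_C_of_isUnit_sub (sub_ne_zero.mpr hab).isUnit)
    (fun β => s.denom.roots.count β)
    (gi := fun β => (algebraMap K[X] (RatFunc K) (X - C β))⁻¹)
    (fun β _ => inv_mul_cancel₀ (hne β))
  have hs : s = algebraMap K[X] (RatFunc K) s.num * ∏ β ∈ s.denom.roots.toFinset,
      (algebraMap K[X] (RatFunc K) (X - C β))⁻¹ ^ s.denom.roots.count β := by
    conv_lhs => rw [← RatFunc.num_div_denom s, hden]
    simp [div_eq_mul_inv]
  rw [hs, h]
  exact V.add_mem (by simpa using hV q 0 0) (V.sum_mem fun β _ => V.sum_mem fun j _ => hV _ _ _)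

end PartialFractions

section PoleReduction

variable {K L : Type*} [Field K] [Field L] [Algebra K L]

/-- The `K`-linear map `a ↦ a · (2y)⁻¹ · dx`. -/
noncomputable def antiInvariantForm (x y : L) : L →ₗ[K] Ω[L⁄K] :=
  (LinearMap.toSpanSingleton L (Ω[L⁄K])
    ((2 * y)⁻¹ • KaehlerDifferential.D K L x)).restrictScalars K

theorem antiInvariantForm_apply (x y a : L) :
    antiInvariantForm (K := K) x y a = (a * (2 * y)⁻¹) • KaehlerDifferential.D K L x := by
  simp [antiInvariantForm, mul_smul]

/-- The `K`-span of the exact differentials and the basis differentials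
`x ^ i · (2y)⁻¹ · dx` for `i < deg g - 1` and `((x - β) · 2y)⁻¹ · dx` for `g(β) ≠ 0`. -/
noncomputable def reducedForms (g : K[X]) (x y : L) : Submodule K (Ω[L⁄K]) :=
  LinearMap.range (KaehlerDifferential.D K L).toLinearMap ⊔
    Submodule.span K (Set.range fun i : Fin (g.natDegree - 1) =>
      antiInvariantForm x y (x ^ (i : ℕ))) ⊔
    Submodule.span K (Set.image (fun β => antiInvariantForm x y (x - algebraMap K L β)⁻¹)
      {β | g.eval β ≠ 0})

theorem exists_of_mem_reducedForms {g : K[X]} {x y : L} {ω : Ω[L⁄K]}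
    (h : ω ∈ reducedForms g x y) :
    ∃ (F : L) (c : Fin (g.natDegree - 1) → K) (k : ℕ) (β : Fin k → K) (d : Fin k → K),
      (∀ j, g.eval (β j) ≠ 0) ∧
      ω = KaehlerDifferential.D K L F +
        (∑ i : Fin (g.natDegree - 1),
          (algebraMap K L (c i) * x ^ (i : ℕ) * (2 * y)⁻¹) • KaehlerDifferential.D K L x) +
        (∑ j : Fin k, (algebraMap K L (d j) * ((x - algebraMap K L (β j)) * (2 * y))⁻¹) •
          KaehlerDifferential.D K L x) := by
  obtain ⟨_, h₁, _, h₃, rfl⟩ := Submodule.mem_sup.mp h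
  obtain ⟨_, ⟨F, rfl⟩, _, h₂, rfl⟩ := Submodule.mem_sup.mp h₁
  obtain ⟨c, rfl⟩ := (Submodule.mem_span_range_iff_exists_fun K).mp h₂
  obtain ⟨k, d, v, rfl⟩ := Submodule.mem_span_set'.mp h₃
  choose β hβ hv using fun j => (v j).2
  refine ⟨F, c, k, β, d, hβ, ?_⟩
  simp only [← hv, antiInvariantForm_apply, ← algebraMap_smul L (_ : K), smul_smul, mul_inv,
    mul_assoc]
  rfl

theorem D_mul_eq_antiInvariantForm [CharZero K] {g : K[X]} {x y : L} (hy : y ≠ 0)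
    (hxy : y ^ 2 = aeval x g) {h h' : L}
    (hh : KaehlerDifferential.D K L h = h' • KaehlerDifferential.D K L x) :
    KaehlerDifferential.D K L (h * y) =
      antiInvariantForm x y (2 * h' * aeval x g + h * aeval x (derivative g)) := by
  have : CharZero L := charZero_of_injective_algebraMap (algebraMap K L).injective
  have h2y : (2 * y) • KaehlerDifferential.D K L y =
      aeval x (derivative g) • KaehlerDifferential.D K L x := by
    rw [← Derivation.map_aeval, ← hxy, Derivation.leibniz_pow, ← Nat.cast_smul_eq_nsmul L,
      smul_smul]
    simp
  have h2 : (2 * y) ≠ 0 := by simp [hy]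
  have hDy : KaehlerDifferential.D K L y =
      ((2 * y)⁻¹ * aeval x (derivative g)) • KaehlerDifferential.D K L x := by
    rw [mul_smul, ← h2y, inv_smul_smul₀ h2]
  rw [Derivation.leibniz, hh, hDy, antiInvariantForm_apply, smul_smul, smul_smul, ← add_smul,
    ← hxy]
  congr 1
  field_simp
  ring

theorem antiInvariantForm_exact_mem [CharZero K] {g : K[X]} {x y : L} (hy : y ≠ 0)
    (hxy : y ^ 2 = aeval x g) {h h' : L}
    (hh : KaehlerDifferential.D K L h = h' • KaehlerDifferential.D K L x) :
    antiInvariantForm x y (2 * h' * aeval x g + h * aeval x (derivative g)) ∈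
      reducedForms g x y := by
  rw [← D_mul_eq_antiInvariantForm hy hxy hh]
  exact Submodule.mem_sup_left (Submodule.mem_sup_left ⟨h * y, rfl⟩)

/-- Reduction of the pole at infinity. -/
theorem antiInvariantForm_aeval_mem [CharZero K] {g : K[X]} (hd : 1 ≤ g.natDegree) {x y : L}
    (hy : y ≠ 0) (hxy : y ^ 2 = aeval x g) (p : K[X]) :
    antiInvariantForm x y (aeval x p) ∈ reducedForms g x y := by
  induction p using Polynomial.induction_on' with
  | add p q hp hq => simpa using add_mem hp hq
  | monomial n a =>
  rw [← C_mul_X_pow_eq_monomial, map_mul, aeval_C, ← Algebra.smul_def, map_smul]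
  refine Submodule.smul_mem _ _ ?_
  clear a
  induction n using Nat.strong_induction_on with
  | _ n ih =>
  by_cases hn : n < g.natDegree - 1
  · rw [map_pow, aeval_X]
    exact Submodule.mem_sup_left (Submodule.mem_sup_right (Submodule.subset_span ⟨⟨n, hn⟩, rfl⟩))
  obtain ⟨m, rfl⟩ : ∃ m, n = m + (g.natDegree - 1) := ⟨n - (g.natDegree - 1), by omega⟩
  set q : K[X] := 2 * derivative (X ^ m) * g + X ^ m * derivative g with hq
  have hqmem : antiInvariantForm x y (aeval x q) ∈ reducedForms g x y := by
    have := antiInvariantForm_exact_mem hy hxy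
      ((KaehlerDifferential.D K L).map_aeval (X ^ m : K[X]) x)
    simpa [hq, map_ofNat] using this
  have hlow (r : K[X]) (hr : ∀ j, m + (g.natDegree - 1) ≤ j → r.coeff j = 0) :
      antiInvariantForm x y (aeval x r) ∈ reducedForms g x y := by
    rw [aeval_eq_sum_range, map_sum]
    refine Submodule.sum_mem _ fun i _ => ?_
    rw [map_smul]
    rcases lt_or_ge i (m + (g.natDegree - 1)) with hi | hi
    · simpa using Submodule.smul_mem _ (r.coeff i) (ih i hi)
    · simp [hr i hi]
  have hcoeff (i : ℕ) : q.coeff (m + i) = (2 * m + i + 1 : ℕ) * g.coeff (i + 1) := by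
    have hXq : X * q = X ^ m * (C (2 * m : K) * g + X * derivative g) := by
      rcases m with _ | m
      · simp [hq]
      · simp only [hq, derivative_X_pow, Nat.add_sub_cancel, map_mul, map_natCast, map_ofNat]
        ring
    rw [← coeff_X_mul, hXq, add_assoc, add_comm m, coeff_X_pow_mul, coeff_add, coeff_C_mul,
      coeff_X_mul, coeff_derivative]
    push_cast
    ring
  set e := q.coeff (m + (g.natDegree - 1)) with he
  have hlc : e ≠ 0 := by
    rw [he, hcoeff, Nat.sub_add_cancel hd]
    refine mul_ne_zero (Nat.cast_ne_zero.mpr (by omega)) ?_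
    exact leadingCoeff_ne_zero.mpr (ne_zero_of_natDegree_gt hd)
  have hr (j : ℕ) (hj : m + (g.natDegree - 1) ≤ j) :
      (q - C e * X ^ (m + (g.natDegree - 1))).coeff j = 0 := by
    rw [coeff_sub, coeff_C_mul_X_pow]
    split_ifs with h
    · rw [h, sub_self]
    · obtain ⟨i, rfl⟩ := Nat.exists_eq_add_of_le (show m ≤ j by omega)
      rw [hcoeff, coeff_eq_zero_of_natDegree_lt (by omega), mul_zero, sub_zero]
  have key := Submodule.smul_mem _ e⁻¹ (sub_mem hqmem (hlow _ hr))
  rw [← map_sub, ← map_sub, ← map_smul, ← map_smul, sub_sub_cancel, ← smul_eq_C_mul,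
    inv_smul_smul₀ hlc] at key
  exact key

/-- The induction step for lowering the order of a pole at `β`. -/
theorem antiInvariantForm_mul_pow_succ_mem {g : K[X]} {x y : L} {β : K}
    (hx : x - algebraMap K L β ≠ 0) {n : ℕ}
    (ih : ∀ p : K[X], antiInvariantForm x y (aeval x p * (x - algebraMap K L β)⁻¹ ^ n) ∈
      reducedForms g x y) {q : K[X]} (hq : q.eval β ≠ 0)
    (hmem : antiInvariantForm x y (aeval x q * (x - algebraMap K L β)⁻¹ ^ (n + 1)) ∈
      reducedForms g x y) (p : K[X]) :
    antiInvariantForm x y (aeval x p * (x - algebraMap K L β)⁻¹ ^ (n + 1)) ∈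
      reducedForms g x y := by
  obtain ⟨r, hr⟩ : X - C β ∣ p - C (p.eval β / q.eval β) * q := by
    rw [dvd_iff_isRoot]
    simp [hq]
  have hp : aeval x p = (x - algebraMap K L β) * aeval x r +
      algebraMap K L (p.eval β / q.eval β) * aeval x q := by
    rw [← sub_eq_iff_eq_add]
    simpa using congrArg (aeval x) hr
  have key := add_mem (ih r) (Submodule.smul_mem _ (p.eval β / q.eval β) hmem)
  rw [← map_smul, ← map_add, Algebra.smul_def] at key
  convert key using 2
  rw [hp, pow_succ]
  field_simp

/-- Reduction of a pole at a finite point. -/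
theorem antiInvariantForm_mul_inv_pow_mem [CharZero K] {g : K[X]} (hg : Squarefree g)
    (hd : 1 ≤ g.natDegree) {x y : L} (hy : y ≠ 0) (hxy : y ^ 2 = aeval x g) {β : K}
    (hx : x - algebraMap K L β ≠ 0) (n : ℕ) (p : K[X]) :
    antiInvariantForm x y (aeval x p * (x - algebraMap K L β)⁻¹ ^ n) ∈
      reducedForms g x y := by
  have hD (n : ℕ) : KaehlerDifferential.D K L ((x - algebraMap K L β)⁻¹ ^ n) =
      (-(n : L) * (x - algebraMap K L β)⁻¹ ^ (n + 1)) • KaehlerDifferential.D K L x := by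
    rw [Derivation.leibniz_pow, Derivation.leibniz_inv, map_sub, Derivation.map_algebraMap,
      sub_zero, ← Nat.cast_smul_eq_nsmul L, smul_smul, smul_smul]
    congr 1
    rcases n with _ | n
    · simp
    · simp only [Nat.add_sub_cancel]
      ring
  have hexact (n : ℕ) : antiInvariantForm x y
      (aeval x ((X - C β) * derivative g - C (2 * n : K) * g) *
        (x - algebraMap K L β)⁻¹ ^ (n + 1)) ∈ reducedForms g x y := by
    convert antiInvariantForm_exact_mem hy hxy (hD n) using 2
    simp only [map_sub, map_mul, aeval_X, aeval_C, map_natCast, map_ofNat, pow_succ]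
    field_simp
    ring
  induction n generalizing p with
  | zero => simpa using antiInvariantForm_aeval_mem hd hy hxy p
  | succ n ih =>
  by_cases hβ : g.eval β = 0
  · obtain ⟨h, rfl⟩ := dvd_iff_isRoot.mpr hβ
    have hh : h.eval β ≠ 0 := fun h0 => by
      obtain ⟨r, rfl⟩ := dvd_iff_isRoot.mpr h0
      exact not_isUnit_X_sub_C β (hg _ ⟨r, by ring⟩)
    refine antiInvariantForm_mul_pow_succ_mem hx ih
      (q := derivative ((X - C β) * h) - C (2 * (n + 1 : ℕ) : K) * h) ?_ ?_ p
    · have : (1 - 2 * (n + 1 : ℕ) : K) ≠ 0 := by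
        rw [sub_ne_zero]
        norm_cast
        omega
      have := mul_ne_zero this hh
      simp only [derivative_mul, derivative_X_sub_C, eval_sub, eval_add, eval_mul, eval_X, eval_C,
        sub_self, zero_mul, add_zero, one_mul]
      rwa [sub_mul, one_mul] at this
    · convert hexact (n + 1) using 2
      simp only [map_sub, map_mul, aeval_X, aeval_C, pow_succ]
      field_simp
  rcases n with _ | n
  · refine antiInvariantForm_mul_pow_succ_mem hx ih (q := 1) (by simp) ?_ p
    refine Submodule.mem_sup_right (Submodule.subset_span ⟨β, hβ, ?_⟩)
    simp
  · exact antiInvariantForm_mul_pow_succ_mem hx ih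
      (by simp [hβ, Nat.cast_add_one_ne_zero]) (hexact (n + 1)) p

end PoleReduction

/-- identity (5.2). Let `K` be algebraically closed of characteristic `0`
and `L = K(X)[Y]/(Y² - g(X))` with `g` squarefree of degree `d ≥ 1`. Every differential
`s(x)·(2y)^{-1}·dx` with `s ∈ K(X)` can be written in `Ω_{L/K}` as
`dF + ∑_{i=0}^{d-2} c_i·x^i·(2y)^{-1}·dx + ∑_{j=1}^{k} d_j·((x-β_j)·2y)^{-1}·dx`
with `F ∈ L`, `c_i, d_j ∈ K` and `g(β_j) ≠ 0` for all `j`. -/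
theorem pole_reduction_to_basis (K : Type) [Field K] [IsAlgClosed K] [CharZero K] (g : K[X])
    (hg : Squarefree g) (hd : 1 ≤ g.natDegree) [Fact (Irreducible (hypPoly K g))]
    (s : RatFunc K) :
    ∃ (F : HypFF K g) (c : Fin (g.natDegree - 1) → K) (k : ℕ) (β : Fin k → K)
      (d : Fin k → K), (∀ j, g.eval (β j) ≠ 0) ∧
      (AdjoinRoot.of (hypPoly K g) s * (2 * yCoord K g)⁻¹) •
          KaehlerDifferential.D K (HypFF K g) (xCoord K g) =
        KaehlerDifferential.D K (HypFF K g) F +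
          (∑ i : Fin (g.natDegree - 1),
            (algebraMap K (HypFF K g) (c i) * xCoord K g ^ (i : ℕ) * (2 * yCoord K g)⁻¹) •
              KaehlerDifferential.D K (HypFF K g) (xCoord K g)) +
          (∑ j : Fin k,
            (algebraMap K (HypFF K g) (d j) *
                ((xCoord K g - algebraMap K (HypFF K g) (β j)) * (2 * yCoord K g))⁻¹) •
              KaehlerDifferential.D K (HypFF K g) (xCoord K g)) := by
  have hroot : yCoord K g ^ 2 = AdjoinRoot.of (hypPoly K g) (algebraMap K[X] (RatFunc K) g) := by
    have h := AdjoinRoot.eval₂_root (hypPoly K g)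
    rw [hypPoly, eval₂_sub, eval₂_X_pow, eval₂_C, sub_eq_zero] at h
    exact h
  have hof (p : K[X]) : AdjoinRoot.of (hypPoly K g) (algebraMap K[X] (RatFunc K) p) =
      aeval (xCoord K g) p := by
    have h : (AdjoinRoot.ofAlgHom K (hypPoly K g)).comp
        (IsScalarTower.toAlgHom K K[X] (RatFunc K)) = aeval (xCoord K g) := by
      ext
      simp [xCoord]
    exact DFunLike.congr_fun h p
  have hxy : yCoord K g ^ 2 = aeval (xCoord K g) g := hroot.trans (hof g)
  have hy : yCoord K g ≠ 0 := by
    intro h0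
    rw [h0, zero_pow two_ne_zero, eq_comm, map_eq_zero] at hroot
    exact hg.ne_zero (RatFunc.algebraMap_injective K (by simpa using hroot))
  have hsub (β : K) : AdjoinRoot.of (hypPoly K g) (algebraMap K[X] (RatFunc K) (X - C β)) =
      xCoord K g - algebraMap K (HypFF K g) β := by
    rw [hof]
    simp
  have hx (β : K) : xCoord K g - algebraMap K (HypFF K g) β ≠ 0 := by
    rw [← hsub, _root_.map_ne_zero]
    exact RatFunc.algebraMap_ne_zero (X_sub_C_ne_zero β)
  have hmem : s ∈ ((reducedForms g (xCoord K g) (yCoord K g)).comap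
      (antiInvariantForm (xCoord K g) (yCoord K g))).comap
      (AdjoinRoot.ofAlgHom K (hypPoly K g)).toLinearMap := by
    refine mem_of_forall_div_X_sub_C_pow_mem _ (fun p β n => ?_) s
    simp only [Submodule.mem_comap, AlgHom.toLinearMap_apply, map_mul, map_pow, map_inv₀]
    change antiInvariantForm _ _ (AdjoinRoot.of (hypPoly K g) _ *
      (AdjoinRoot.of (hypPoly K g) _)⁻¹ ^ n) ∈ _
    rw [hof, hsub]
    exact antiInvariantForm_mul_inv_pow_mem hg hd hy hxy (hx β) n p
  simpa only [antiInvariantForm_apply, AlgHom.toLinearMap_apply, AdjoinRoot.coe_ofAlgHom] using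
    exists_of_mem_reducedForms hmem
end
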